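/- With the notation in the context, the function G, defined on the open convex set of symmetric positive definite K × K real matrices by G(Σ) = (1/2)·log det Σ − (1/2)·tr( Ω^{−1} Σ ) − Σ_{t=1}^T log( Σ_{j=1}^J exp( x_{tj}ᵀ μ + (1/2)·x_{tj}ᵀ Σ x_{tj} ) ), is Fréchet differentiable, and its derivative at Σ in any symmetric direction H equals (1/2)·tr( ( Σ^{−1} − Ω^{−1} − Σ_{t=1}^T x_tᵀ·diag(w_t(Σ))·x_t )·H ), where x_t is the J × K matrix with rows x_{t1}ᵀ, …, x_{tJ}ᵀ and w_t(Σ) ∈ ℝ^J has entries w_{tj}(Σ) := exp( x_{tj}ᵀ μ + (1/2)·x_{tj}ᵀ Σ x_{tj} ) / Σ_{j'=1}^J exp( x_{tj'}ᵀ μ + (1/2)·x_{tj'}ᵀ Σ x_{tj'} ). -/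

import Mathlib

open Matrix

-- Equip matrix space with its (elementwise sup) norm; all norms on this
-- finite-dimensional space are equivalent, so Fréchet differentiability and the
-- derivative do not depend on this choice.
attribute [local instance] Matrix.normedAddCommGroup Matrix.normedSpace

/-- The part of the D0 variational objective depending on the variational
covariance `Σ`:
`G(Σ) = (1/2)·log det Σ − (1/2)·tr(Ω⁻¹Σ) − ∑ₜ log ∑ⱼ exp(x_{tj}ᵀμ + (1/2)x_{tj}ᵀΣx_{tj})`. -/
noncomputable def covObjective (J K T : ℕ) (x : Fin T → Fin J → Fin K → ℝ)
    (μ : Fin K → ℝ) (Ω : Matrix (Fin K) (Fin K) ℝ) :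
    Matrix (Fin K) (Fin K) ℝ → ℝ :=
  fun S =>
    (1 / 2) * Real.log S.det - (1 / 2) * (Ω⁻¹ * S).trace
      - ∑ t, Real.log (∑ j, Real.exp (x t j ⬝ᵥ μ + (1 / 2) * (x t j ⬝ᵥ (S *ᵥ x t j))))

/-- The softmax weight vector `w_t(Σ)`, with entries
`w_{tj}(Σ) = exp(x_{tj}ᵀμ + (1/2)x_{tj}ᵀΣx_{tj}) / ∑_{j'} exp(x_{tj'}ᵀμ + (1/2)x_{tj'}ᵀΣx_{tj'})`. -/
noncomputable def covSoftmaxVec (J K T : ℕ) (x : Fin T → Fin J → Fin K → ℝ)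
    (μ : Fin K → ℝ) (S : Matrix (Fin K) (Fin K) ℝ) (t : Fin T) : Fin J → ℝ :=
  fun j => Real.exp (x t j ⬝ᵥ μ + (1 / 2) * (x t j ⬝ᵥ (S *ᵥ x t j)))
    / ∑ j', Real.exp (x t j' ⬝ᵥ μ + (1 / 2) * (x t j' ⬝ᵥ (S *ᵥ x t j')))

namespace Matrix

variable {m n : Type*} [Fintype m] [Fintype n]

lemma differentiable_det [DecidableEq n] :
    Differentiable ℝ (fun M : Matrix n n ℝ => M.det) := by
  have entry (i j : n) : Differentiable ℝ (fun M : Matrix n n ℝ => M i j) :=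
    (entryLinearMap ℝ ℝ i j).toContinuousLinearMap.differentiable
  simp only [det_apply']
  fun_prop

lemma differentiable_trace_mul (A : Matrix n n ℝ) :
    Differentiable ℝ (fun M : Matrix n n ℝ => (A * M).trace) :=
  ((traceLinearMap n ℝ ℝ).comp (LinearMap.mulLeft ℝ A)).toContinuousLinearMap.differentiable

lemma differentiable_dotProduct_mulVec (v : n → ℝ) :
    Differentiable ℝ (fun M : Matrix n n ℝ => v ⬝ᵥ (M *ᵥ v)) := by
  have entry (i j : n) : Differentiable ℝ (fun M : Matrix n n ℝ => M i j) :=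
    (entryLinearMap ℝ ℝ i j).toContinuousLinearMap.differentiable
  simp only [dotProduct, mulVec]
  fun_prop

/-- **Jacobi's formula** along a line through an invertible matrix. -/
lemma hasDerivAt_det_add_smul [DecidableEq n] {A : Matrix n n ℝ} (hA : IsUnit A.det)
    (H : Matrix n n ℝ) :
    HasDerivAt (fun r : ℝ => (A + r • H).det) (A.det * (A⁻¹ * H).trace) 0 := by
  set p := (det (1 + (Polynomial.X : Polynomial ℝ) • (A⁻¹ * H).map Polynomial.C)).divX.divX
  have key : (fun r : ℝ => (A + r • H).det) =
      fun r : ℝ => A.det * (1 + (A⁻¹ * H).trace * r + p.eval r * r ^ 2) := by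
    funext r
    rw [← det_one_add_smul, ← det_mul, Matrix.mul_add, Matrix.mul_one, Matrix.mul_smul,
      mul_nonsing_inv_cancel_left _ _ hA]
  rw [key]
  have hid := hasDerivAt_id (0 : ℝ)
  simpa using! ((((hid.const_mul (A⁻¹ * H).trace).const_add 1).add
    ((p.hasDerivAt 0).mul (hid.pow 2))).const_mul A.det)

lemma trace_transpose_mul_diagonal_mul_mul [DecidableEq m] (X : Matrix m n ℝ) (w : m → ℝ)
    (H : Matrix n n ℝ) :
    (Xᵀ * diagonal w * X * H).trace = ∑ j, w j * (X j ⬝ᵥ (H *ᵥ X j)) := by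
  rw [Matrix.mul_assoc, trace_mul_comm, ← Matrix.mul_assoc, trace_mul_comm]
  simp only [trace, diag_apply, diagonal_mul]
  refine Finset.sum_congr rfl fun j _ => ?_
  rw [Matrix.mul_assoc X H, mul_apply']
  rfl

end Matrix

lemma differentiableAt_covObjective {J K T : ℕ} (hJ : 0 < J)
    (x : Fin T → Fin J → Fin K → ℝ) (μ : Fin K → ℝ) (Ω : Matrix (Fin K) (Fin K) ℝ)
    {S : Matrix (Fin K) (Fin K) ℝ} (hS : S.det ≠ 0) :
    DifferentiableAt ℝ (covObjective J K T x μ Ω) S := by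
  have : Nonempty (Fin J) := ⟨⟨0, hJ⟩⟩
  have hdet := differentiable_det (n := Fin K) S
  have htr := differentiable_trace_mul Ω⁻¹ S
  have hquad (t : Fin T) (j : Fin J) := differentiable_dotProduct_mulVec (x t j) S
  refine (((hdet.log hS).const_mul _).sub (htr.const_mul _)).sub
    (DifferentiableAt.fun_sum fun t _ => DifferentiableAt.log
      (DifferentiableAt.fun_sum fun j _ => (((hquad t j).const_mul _).const_add _).exp) ?_)
  exact (Finset.sum_pos (fun j _ => Real.exp_pos _) Finset.univ_nonempty).ne'

lemma hasLineDerivAt_covObjective {J K T : ℕ} (hJ : 0 < J)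
    (x : Fin T → Fin J → Fin K → ℝ) (μ : Fin K → ℝ) (Ω : Matrix (Fin K) (Fin K) ℝ)
    {S : Matrix (Fin K) (Fin K) ℝ} (hS : S.det ≠ 0) (H : Matrix (Fin K) (Fin K) ℝ) :
    HasLineDerivAt ℝ (covObjective J K T x μ Ω)
      ((1 / 2) * (((S⁻¹ - Ω⁻¹
            - ∑ t, (Matrix.of (x t))ᵀ * Matrix.diagonal (covSoftmaxVec J K T x μ S t)
                * Matrix.of (x t)) * H).trace)) S H := by
  have : Nonempty (Fin J) := ⟨⟨0, hJ⟩⟩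
  have hdet := (hasDerivAt_det_add_smul hS.isUnit H).log (by simpa using hS)
  have htr : HasDerivAt (fun r : ℝ => (Ω⁻¹ * (S + r • H)).trace) (Ω⁻¹ * H).trace 0 := by
    simpa [Matrix.mul_add] using
      ((hasDerivAt_id (0 : ℝ)).mul_const (Ω⁻¹ * H).trace).const_add (Ω⁻¹ * S).trace
  have hquad (t : Fin T) (j : Fin J) :
      HasDerivAt (fun r : ℝ => x t j ⬝ᵥ ((S + r • H) *ᵥ x t j)) (x t j ⬝ᵥ (H *ᵥ x t j)) 0 := by
    simpa [Matrix.add_mulVec, Matrix.smul_mulVec] using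
      ((hasDerivAt_id (0 : ℝ)).mul_const (x t j ⬝ᵥ (H *ᵥ x t j))).const_add
        (x t j ⬝ᵥ (S *ᵥ x t j))
  have hsum (t : Fin T) := (HasDerivAt.fun_sum (u := Finset.univ) fun j _ =>
    (((hquad t j).const_mul (1 / 2)).const_add (x t j ⬝ᵥ μ)).exp).log
      (Finset.sum_pos (fun j _ => Real.exp_pos _) Finset.univ_nonempty).ne'
  refine (((hdet.const_mul (1 / 2)).sub (htr.const_mul (1 / 2))).sub
    (HasDerivAt.fun_sum fun t _ => hsum t)).congr_deriv ?_
  simp only [zero_smul, add_zero, mul_div_cancel_left₀ _ hS, Matrix.sub_mul, Matrix.trace_sub,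
    Finset.sum_mul, Matrix.trace_sum, Matrix.trace_transpose_mul_diagonal_mul_mul, mul_sub,
    Finset.mul_sum, Finset.sum_div]
  congr 1
  refine Finset.sum_congr rfl fun t _ => Finset.sum_congr rfl fun j _ => ?_
  rw [show Matrix.of (x t) j = x t j from rfl, covSoftmaxVec]
  ring

/-- at every symmetric positive definite `Σ`, the objective `G` is
Fréchet differentiable, and its derivative in any symmetric direction `H` equals
`(1/2)·tr((Σ⁻¹ − Ω⁻¹ − ∑ₜ xₜᵀ·diag(wₜ(Σ))·xₜ)·H)`, where `xₜ` is the `J × K`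
matrix with rows `x_{tj}ᵀ`. -/
theorem stmt_15 (J K T : ℕ) (hJ : 0 < J) (hK : 0 < K) (hT : 0 < T)
    (x : Fin T → Fin J → Fin K → ℝ) (μ : Fin K → ℝ)
    (Ω : Matrix (Fin K) (Fin K) ℝ) (hΩ : Ω.PosDef)
    (S : Matrix (Fin K) (Fin K) ℝ) (hS : S.PosDef) :
    DifferentiableAt ℝ (covObjective J K T x μ Ω) S
      ∧
    ∀ H : Matrix (Fin K) (Fin K) ℝ, H.IsSymm →
      fderiv ℝ (covObjective J K T x μ Ω) S H
        = (1 / 2) * (((S⁻¹ - Ω⁻¹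
            - ∑ t, (Matrix.of (x t))ᵀ * Matrix.diagonal (covSoftmaxVec J K T x μ S t)
                * Matrix.of (x t)) * H).trace) := by
  have hdet : S.det ≠ 0 := hS.det_pos.ne'
  have hdiff := differentiableAt_covObjective hJ x μ Ω hdet
  refine ⟨hdiff, fun H _ => ?_⟩
  exact hdiff.lineDeriv_eq_fderiv.symm.trans
    (hasLineDerivAt_covObjective hJ x μ Ω hdet H).lineDeriv
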